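/- arXiv:2006.16688 — 2 statements merged into one kernel-verified Lean document; each statement's English description precedes it below -/
import Mathlib

section
/- Let I and S be timed labeled transition systems over the same alphabet Σ = Σ? ∪ Σ! of input and output actions, and suppose both I and S are deterministic and input-enabled. Then I refines S (I ≤ S, i.e., there exists a timed simulation relation as in the definition of refinement) if and only if every finite trace of I is also a finite trace of S. -/
/-- Labels of a timed labeled transition system: inputs, outputs, and
nonnegative real delays. -/
inductive TLabel (In Out : Type) where
  | inp : In → TLabel In Out
  | out : Out → TLabel In Out
  | delay : NNReal → TLabel In Out

/-- A timed labeled transition system over alphabet `Σ? = In`, `Σ! = Out`. -/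
structure TLTS (In Out : Type) where
  Q : Type
  init : Q
  step : Q → TLabel In Out → Q → Prop

/-- A TLTS is deterministic: each label has at most one successor from each state. -/
def TLTS.Deterministic {In Out : Type} (T : TLTS In Out) : Prop :=
  ∀ q a q₁ q₂, T.step q a q₁ → T.step q a q₂ → q₁ = q₂

/-- A TLTS is input-enabled: every input is enabled in every state. -/
def TLTS.InputEnabled {In Out : Type} (T : TLTS In Out) : Prop :=
  ∀ q i, ∃ q', T.step q (TLabel.inp i) q'

/-- Finite runs of a transition relation, labelled by a finite word. -/
inductive RunOn {Q L : Type} (step : Q → L → Q → Prop) : Q → List L → Q → Prop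
  | nil (q : Q) : RunOn step q [] q
  | cons {q q' q'' : Q} {a : L} {w : List L} :
      step q a q' → RunOn step q' w q'' → RunOn step q (a :: w) q''

/-- `w` is a finite trace of `T`: some run from the initial state is labelled by `w`. -/
def TLTS.IsTrace {In Out : Type} (T : TLTS In Out) (w : List (TLabel In Out)) : Prop :=
  ∃ q, RunOn T.step T.init w q

/-- `I` refines `S`: there is a timed simulation relation containing the pair of
initial states, where inputs of `S` are matched by `I`, and outputs and delays
of `I` are matched by `S`. -/
def Refines {In Out : Type} (I S : TLTS In Out) : Prop :=
  ∃ R : I.Q → S.Q → Prop, R I.init S.init ∧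
    ∀ qI qS, R qI qS →
      (∀ i qS', S.step qS (TLabel.inp i) qS' →
        ∃ qI', I.step qI (TLabel.inp i) qI' ∧ R qI' qS') ∧
      (∀ o qI', I.step qI (TLabel.out o) qI' →
        ∃ qS', S.step qS (TLabel.out o) qS' ∧ R qI' qS') ∧
      (∀ δ qI', I.step qI (TLabel.delay δ) qI' →
        ∃ qS', S.step qS (TLabel.delay δ) qS' ∧ R qI' qS')

/-- The traces executable from `p` are executable from `q`. -/
def RunInclusion {P Q L : Type} (stepP : P → L → P → Prop) (stepQ : Q → L → Q → Prop)
    (p : P) (q : Q) : Prop :=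
  ∀ w p', RunOn stepP p w p' → ∃ q', RunOn stepQ q w q'

/-- Trace inclusion is preserved by equally labelled steps when the including system is
deterministic. -/
theorem RunInclusion.of_step {P Q L : Type} {stepP : P → L → P → Prop}
    {stepQ : Q → L → Q → Prop} (hdet : ∀ q a q₁ q₂, stepQ q a q₁ → stepQ q a q₂ → q₁ = q₂)
    {p p' : P} {q q' : Q} {a : L} (h : RunInclusion stepP stepQ p q)
    (hp : stepP p a p') (hq : stepQ q a q') : RunInclusion stepP stepQ p' q' := by
  intro w p'' hw
  obtain ⟨q'', hrun⟩ := h (a :: w) p'' (.cons hp hw)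
  cases hrun with
  | cons hstep hrest =>
    obtain rfl := hdet _ _ _ _ hstep hq
    exact ⟨q'', hrest⟩

theorem RunInclusion.exists_step {P Q L : Type} {stepP : P → L → P → Prop}
    {stepQ : Q → L → Q → Prop} {p p' : P} {q : Q} {a : L}
    (h : RunInclusion stepP stepQ p q) (hp : stepP p a p') : ∃ q', stepQ q a q' := by
  obtain ⟨_, hrun⟩ := h [a] p' (.cons hp (.nil p'))
  cases hrun with
  | cons hstep _ => exact ⟨_, hstep⟩

/-- A relation along which every step is matched forward implies trace inclusion. -/
theorem RunInclusion.of_simulation {P Q L : Type} {stepP : P → L → P → Prop}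
    {stepQ : Q → L → Q → Prop} {R : P → Q → Prop}
    (hR : ∀ p q, R p q → ∀ a p', stepP p a p' → ∃ q', stepQ q a q' ∧ R p' q')
    {p : P} {q : Q} (h : R p q) : RunInclusion stepP stepQ p q := by
  intro w p' hw
  induction hw generalizing q with
  | nil => exact ⟨q, .nil q⟩
  | cons hstep _ ih =>
    obtain ⟨q₁, hq, h₁⟩ := hR _ _ h _ _ hstep
    obtain ⟨q₂, hrun⟩ := ih h₁
    exact ⟨q₂, .cons hq hrun⟩

/-- For deterministic, input-enabled TLTS, refinement coincides with
finite-trace inclusion. -/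
theorem refines_iff_trace_inclusion {In Out : Type} (I S : TLTS In Out)
    (hIdet : I.Deterministic) (hIen : I.InputEnabled)
    (hSdet : S.Deterministic) (hSen : S.InputEnabled) :
    Refines I S ↔ ∀ w, I.IsTrace w → S.IsTrace w := by
  constructor
  · rintro ⟨R, hinit, hR⟩ w ⟨p, hp⟩
    refine RunInclusion.of_simulation (R := R) ?_ hinit w p hp
    intro qI qS h a qI' hstep
    cases a with
    | inp i =>
      obtain ⟨qS', hS⟩ := hSen qS i
      obtain ⟨q, hq, hqR⟩ := (hR qI qS h).1 i qS' hS
      obtain rfl := hIdet _ _ _ _ hq hstep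
      exact ⟨qS', hS, hqR⟩
    | out o => exact (hR qI qS h).2.1 o qI' hstep
    | delay δ => exact (hR qI qS h).2.2 δ qI' hstep
  · intro h
    refine ⟨RunInclusion I.step S.step, fun w p hp => h w ⟨p, hp⟩, ?_⟩
    intro qI qS hq
    refine ⟨fun i qS' hS => ?_, fun o qI' hI => ?_, fun δ qI' hI => ?_⟩
    · obtain ⟨qI', hI⟩ := hIen qI i
      exact ⟨qI', hI, hq.of_step hSdet hI hS⟩
    · obtain ⟨qS', hS⟩ := hq.exists_step hI
      exact ⟨qS', hS, hq.of_step hSdet hI hS⟩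
    · obtain ⟨qS', hS⟩ := hq.exists_step hI
      exact ⟨qS', hS, hq.of_step hSdet hI hS⟩
end

section
/- Let Spec = S be a deterministic, input-enabled timed labeled transition system over alphabet Σ = Σ? ∪ Σ!, let M be its monitor, and let Sys = I be any deterministic, input-enabled TLTS over the same alphabet. Form the synchronous parallel composition I ∥ M in which, on every label a ∈ Σ ∪ ℝ≥0, both components take an a-transition simultaneously (M is input-enabled on all labels by construction). Then I refines S (I ≤ S) if and only if no state of the form (q, ERR) is reachable from the initial state (q0^I, q0^S) in I ∥ M. -/
/-- A label is an output or a delay (i.e., in `Σ! ∪ ℝ≥0`). -/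
def TLabel.IsOutputOrDelay {In Out : Type} : TLabel In Out → Prop
  | .inp _ => False
  | .out _ => True
  | .delay _ => True

/-- The transition relation of the monitor of `S`.  Its states are
`S.Q ⊕ Unit`, where `Sum.inr ()` is the error state `ERR`.  It mimics `S`;
whenever `S` cannot perform an observed output or delay, the monitor moves to
`ERR`, and `ERR` is absorbing. -/
inductive MonStep {In Out : Type} (S : TLTS In Out) :
    (S.Q ⊕ Unit) → TLabel In Out → (S.Q ⊕ Unit) → Prop
  | ok {q : S.Q} {a : TLabel In Out} {q' : S.Q} :
      S.step q a q' → MonStep S (Sum.inl q) a (Sum.inl q')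
  | err {q : S.Q} {a : TLabel In Out} :
      a.IsOutputOrDelay → (¬ ∃ q', S.step q a q') → MonStep S (Sum.inl q) a (Sum.inr ())
  | sink {a : TLabel In Out} : MonStep S (Sum.inr ()) a (Sum.inr ())

/-- The transition relation of the synchronous parallel composition `I ∥ M`,
where `M` is the monitor of `S`: on every label both components move
simultaneously. -/
def ProdStep {In Out : Type} (I S : TLTS In Out) :
    I.Q × (S.Q ⊕ Unit) → TLabel In Out → I.Q × (S.Q ⊕ Unit) → Prop :=
  fun p a p' => I.step p.1 a p'.1 ∧ MonStep S p.2 a p'.2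

/-- Along a joint step out of simulation-related states of deterministic systems,
the monitor follows the specification and the simulation is preserved. -/
theorem ProdStep.exists_related {In Out : Type} {I S : TLTS In Out}
    (hIdet : I.Deterministic) (hSdet : S.Deterministic) {R : I.Q → S.Q → Prop}
    (hR : ∀ qI qS, R qI qS →
      (∀ i qS', S.step qS (TLabel.inp i) qS' →
        ∃ qI', I.step qI (TLabel.inp i) qI' ∧ R qI' qS') ∧
      (∀ o qI', I.step qI (TLabel.out o) qI' →
        ∃ qS', S.step qS (TLabel.out o) qS' ∧ R qI' qS') ∧
      (∀ δ qI', I.step qI (TLabel.delay δ) qI' →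
        ∃ qS', S.step qS (TLabel.delay δ) qS' ∧ R qI' qS'))
    {p p' : I.Q} {q : S.Q} {m : S.Q ⊕ Unit} {a : TLabel In Out} (hpq : R p q)
    (h : ProdStep I S (p, Sum.inl q) a (p', m)) :
    ∃ q', m = Sum.inl q' ∧ R p' q' := by
  obtain ⟨hI : I.step p a p', hM : MonStep S (Sum.inl q) a m⟩ := h
  obtain ⟨hinp, hout, hdelay⟩ := hR p q hpq
  cases hM with
  | @ok _ _ q' hS =>
    refine ⟨q', rfl, ?_⟩
    cases a with
    | inp i =>
      obtain ⟨p₁, hp₁, h₁⟩ := hinp i q' hS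
      exact hIdet _ _ _ _ hp₁ hI ▸ h₁
    | out o =>
      obtain ⟨q₁, hq₁, h₁⟩ := hout o p' hI
      exact hSdet _ _ _ _ hq₁ hS ▸ h₁
    | delay δ =>
      obtain ⟨q₁, hq₁, h₁⟩ := hdelay δ p' hI
      exact hSdet _ _ _ _ hq₁ hS ▸ h₁
  | err ha hno =>
    cases a with
    | inp i => exact ha.elim
    | out o =>
      obtain ⟨q₁, hq₁, _⟩ := hout o p' hI
      exact (hno ⟨q₁, hq₁⟩).elim
    | delay δ =>
      obtain ⟨q₁, hq₁, _⟩ := hdelay δ p' hI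
      exact (hno ⟨q₁, hq₁⟩).elim

/-- A property preserved by every step holds at the end of a run if it holds at its start. -/
theorem RunOn.invariant {Q L : Type} {step : Q → L → Q → Prop} {P : Q → Prop}
    (hP : ∀ x a y, P x → step x a y → P y) {x y : Q} {w : List L}
    (h : RunOn step x w y) (hx : P x) : P y := by
  induction h with
  | nil => exact hx
  | cons hstep _ ih => exact ih (hP _ _ _ hx hstep)

/-- If no error is reachable from `(p, q)`, then any output or delay of `I` at `p` is
matched by `S` at `q`. -/
theorem TLTS.exists_step_of_err_unreachable {In Out : Type} {I S : TLTS In Out}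
    {p p' : I.Q} {q : S.Q} {a : TLabel In Out}
    (h : ¬ ∃ (w : List (TLabel In Out)) (r : I.Q),
      RunOn (ProdStep I S) (p, Sum.inl q) w (r, Sum.inr ()))
    (ha : a.IsOutputOrDelay) (hI : I.step p a p') : ∃ q', S.step q a q' := by
  by_contra hno
  exact h ⟨[a], p', .cons ⟨hI, .err ha hno⟩ (.nil _)⟩

/-- `I` refines `S` if and only if no state of the form `(q, ERR)` is reachable
from the initial state `(I.init, S.init)` in the composition `I ∥ M` of `I`
with the monitor `M` of `S`. -/
theorem refines_iff_err_unreachable {In Out : Type} (I S : TLTS In Out)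
    (hIdet : I.Deterministic) (hIen : I.InputEnabled)
    (hSdet : S.Deterministic) (hSen : S.InputEnabled) :
    Refines I S ↔
      ¬ ∃ (w : List (TLabel In Out)) (q : I.Q),
          RunOn (ProdStep I S) (I.init, Sum.inl S.init) w (q, Sum.inr ()) := by
  constructor
  · rintro ⟨R, h₀, hR⟩ ⟨w, r, hrun⟩
    have hinv : ∃ q', (Sum.inr () : S.Q ⊕ Unit) = Sum.inl q' ∧ R r q' := by
      refine hrun.invariant (P := fun x => ∃ q', x.2 = Sum.inl q' ∧ R x.1 q') ?_
        ⟨S.init, rfl, h₀⟩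
      rintro ⟨p, _⟩ a ⟨p', m⟩ ⟨q, rfl, hpq⟩ hstep
      exact hstep.exists_related hIdet hSdet hR hpq
    obtain ⟨_, hne, _⟩ := hinv
    cases hne
  · intro h
    refine ⟨fun p q => ¬ ∃ (w : List (TLabel In Out)) (r : I.Q),
      RunOn (ProdStep I S) (p, Sum.inl q) w (r, Sum.inr ()), h, fun p q hpq => ?_⟩
    have hnext : ∀ {a p' q'}, I.step p a p' → S.step q a q' →
        ¬ ∃ (w : List (TLabel In Out)) (r : I.Q),
          RunOn (ProdStep I S) (p', Sum.inl q') w (r, Sum.inr ()) := by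
      rintro a p' q' hI hS ⟨w, r, hrun⟩
      exact hpq ⟨a :: w, r, .cons ⟨hI, .ok hS⟩ hrun⟩
    refine ⟨fun i q' hS => ?_, fun o p' hI => ?_, fun δ p' hI => ?_⟩
    · obtain ⟨p', hI⟩ := hIen p i
      exact ⟨p', hI, hnext hI hS⟩
    · obtain ⟨q', hS⟩ := TLTS.exists_step_of_err_unreachable (a := .out o) hpq trivial hI
      exact ⟨q', hS, hnext hI hS⟩
    · obtain ⟨q', hS⟩ := TLTS.exists_step_of_err_unreachable (a := .delay δ) hpq trivial hI
      exact ⟨q', hS, hnext hI hS⟩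
end
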